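/- Under the standing assumptions, and with E_0 a constant as specified, there exists L_1 > 0 such that for every natural number L > L_1, every ε > 0, and every n ∈ ℕ with ⌈εn⌉ ≥ 1, the following holds for every g ∈ W_{L,ε}(n): there exists h ∈ G such that, setting ψ := h φ h^{-1}, for every sufficiently large integer i there exist points p ∈ π_{[ψ^{-i}x_0, ψ^{i}x_0]}(g^{-i} x_0) and q ∈ π_{[ψ^{-i}x_0, ψ^{i}x_0]}(g^{i} x_0) with p occurring before q along the geodesic [ψ^{-i}x_0, ψ^{i}x_0] (oriented from ψ^{-i}x_0 to ψ^{i}x_0) and d_X(p,q) ≥ τL/2. -/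

import Mathlib

namespace AcylCount

/-! ### Geodesic segments and Gromov hyperbolicity -/

/-- A finite geodesic segment in a metric space, parametrized by arclength on `[0, len]`,
oriented from `initial := toFun 0` to `terminal := toFun len`. -/
structure GeodesicSegment (X : Type*) [MetricSpace X] where
  len : ℝ
  len_nonneg : 0 ≤ len
  toFun : ℝ → X
  isom : ∀ s ∈ Set.Icc (0:ℝ) len, ∀ t ∈ Set.Icc (0:ℝ) len,
    dist (toFun s) (toFun t) = |s - t|

namespace GeodesicSegment

variable {X : Type*} [MetricSpace X]

/-- The initial point of a geodesic segment. -/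
def initial (γ : GeodesicSegment X) : X := γ.toFun 0

/-- The terminal point of a geodesic segment. -/
def terminal (γ : GeodesicSegment X) : X := γ.toFun γ.len

/-- The image (underlying set) of a geodesic segment. -/
def seg (γ : GeodesicSegment X) : Set X := γ.toFun '' Set.Icc 0 γ.len

/-- The translate of a geodesic segment by an isometry. -/
def translate (γ : GeodesicSegment X) (f : X → X) (hf : Isometry f) :
    GeodesicSegment X where
  len := γ.len
  len_nonneg := γ.len_nonneg
  toFun := f ∘ γ.toFun
  isom := fun s hs t ht => by
    simp only [Function.comp_apply, hf.dist_eq]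
    exact γ.isom s hs t ht

/-- The degenerate geodesic segment consisting of a single point. -/
def point (p : X) : GeodesicSegment X where
  len := 0
  len_nonneg := le_refl 0
  toFun := fun _ => p
  isom := fun s hs t ht => by
    have hs0 : s = 0 := le_antisymm hs.2 hs.1
    have ht0 : t = 0 := le_antisymm ht.2 ht.1
    simp [hs0, ht0]

/-- `η` is a subsegment of `γ`. -/
def IsSubsegment (η γ : GeodesicSegment X) : Prop :=
  ∃ a b : ℝ, 0 ≤ a ∧ a ≤ b ∧ b ≤ γ.len ∧ η.len = b - a ∧
    ∀ t ∈ Set.Icc (0:ℝ) η.len, η.toFun t = γ.toFun (a + t)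

/-- `p` occurs (weakly) before `q` along the oriented geodesic segment `γ`. -/
def Before (γ : GeodesicSegment X) (p q : X) : Prop :=
  ∃ s t : ℝ, s ∈ Set.Icc (0:ℝ) γ.len ∧ t ∈ Set.Icc (0:ℝ) γ.len ∧ s ≤ t ∧
    γ.toFun s = p ∧ γ.toFun t = q

end GeodesicSegment

/-- A geodesic metric space: every two points are joined by a geodesic segment. -/
def IsGeodesicSpace (X : Type*) [MetricSpace X] : Prop :=
  ∀ x y : X, ∃ γ : GeodesicSegment X, γ.initial = x ∧ γ.terminal = y

/-- δ-hyperbolicity via slim triangles: each side of a geodesic triangle lies in the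
closed δ-neighborhood of the union of the other two sides. -/
def IsDeltaHyperbolic (X : Type*) [MetricSpace X] (δ : ℝ) : Prop :=
  ∀ γ₁ γ₂ γ₃ : GeodesicSegment X,
    γ₁.initial = γ₃.initial → γ₁.terminal = γ₂.initial → γ₂.terminal = γ₃.terminal →
    γ₃.seg ⊆ Metric.cthickening δ (γ₁.seg ∪ γ₂.seg)

variable {X : Type*} [MetricSpace X]

/-- The closest point projection of `x` to (the image of) the geodesic `γ`. -/
def proj (γ : GeodesicSegment X) (x : X) : Set X :=
  {p | p ∈ γ.seg ∧ dist x p = Metric.infDist x γ.seg}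

/-- The closest point projection of a set `A` to the geodesic `γ`. -/
def projSet (γ : GeodesicSegment X) (A : Set X) : Set X :=
  ⋃ a ∈ A, proj γ a

/-- The ordered pair of oriented geodesic segments `(γ, η)` is `K`-aligned. -/
def AlignedPair (K : ℝ) (γ η : GeodesicSegment X) : Prop :=
  Metric.diam (projSet γ η.seg ∪ {γ.terminal}) < K ∧
  Metric.diam (projSet η γ.seg ∪ {η.initial}) < K

/-- A sequence of oriented geodesic segments is `K`-aligned if each consecutive
pair is `K`-aligned. -/
def AlignedSeq (K : ℝ) (l : List (GeodesicSegment X)) : Prop :=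
  l.Chain' (AlignedPair K)

/-- The Gromov product `(y, z)_x`. -/
noncomputable def gromovProd (x y z : X) : ℝ := (dist y x + dist x z - dist y z) / 2

/-! ### Word metric -/

variable {G : Type*} [Group G]

/-- The word length of `g` with respect to the (symmetrized) generating set `S`. -/
noncomputable def wordLength (S : Finset G) (g : G) : ℕ :=
  sInf {n | ∃ l : List G, l.length = n ∧ (∀ x ∈ l, x ∈ S ∨ x⁻¹ ∈ S) ∧ l.prod = g}

/-- The word metric on `G` with respect to `S`. -/
noncomputable def wordDist (S : Finset G) (g h : G) : ℕ := wordLength S (g⁻¹ * h)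

/-- The ball of radius `r` in the word metric, centered at the identity. -/
def ball (S : Finset G) (r : ℝ) : Set G := {g | (wordLength S g : ℝ) ≤ r}

/-- `G` has no cyclic subgroup of finite index. -/
def NonVirtuallyCyclic (G : Type*) [Group G] : Prop :=
  ¬ ∃ H : Subgroup G, H.FiniteIndex ∧ IsCyclic H

/-! ### Isometric actions, loxodromics, WPD -/

/-- `g` is a loxodromic isometry for the action `ρ` with basepoint `x0`: the asymptotic
translation length `τ_X(g) = lim dist x0 (g^n x0) / n` exists and is positive. -/
def IsLoxodromic (ρ : G → X → X) (x0 : X) (g : G) : Prop :=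
  ∃ τ : ℝ, 0 < τ ∧
    Filter.Tendsto (fun n : ℕ => dist x0 (ρ (g ^ n) x0) / n) Filter.atTop (nhds τ)

/-- The WPD (weak proper discontinuity) property of `g` for the action `ρ` with
basepoint `x0`. -/
def HasWPD (ρ : G → X → X) (x0 : X) (g : G) : Prop :=
  ∀ K : ℝ, 0 < K → ∃ N M : ℕ,
    {h : G | dist x0 (ρ h x0) < K ∧ dist (ρ (g ^ N) x0) (ρ h (ρ (g ^ N) x0)) < K}.Finite ∧
    {h : G | dist x0 (ρ h x0) < K ∧ dist (ρ (g ^ N) x0) (ρ h (ρ (g ^ N) x0)) < K}.ncard < M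

/-- The list of translated geodesics `h 1 • Υ, …, h m • Υ`. -/
def transList (ρ : G → X → X) (hisom : ∀ g : G, Isometry (ρ g))
    (Υ : GeodesicSegment X) (h : ℕ → G) (m : ℕ) : List (GeodesicSegment X) :=
  (List.range m).map fun i => Υ.translate (ρ (h (i + 1))) (hisom _)

/-- The specification of the constant `E₀` from Fact 2.7 (Bestvina–Fujiwara):
(i) Gromov product bounds, (ii) the WPD-type conclusion for large projections. -/
def E0Spec (S : Finset G) (ρ : G → X → X) (x0 : X) (φ : G) (E0 : ℝ) : Prop :=
  0 < E0 ∧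
  (∀ g : G, ∃ s t : G, (s ∈ S ∨ s = 1) ∧ (t ∈ S ∨ t = 1) ∧
    (∀ i : ℤ, 0 < i → gromovProd x0 (ρ (φ ^ i) x0) (ρ (s * g) x0) ≤ E0) ∧
    (∀ j : ℤ, j < 0 → gromovProd x0 (ρ (φ ^ j) x0) (ρ (t * g) x0) ≤ E0)) ∧
  (∀ n : ℕ, 0 < n → ∀ g : G, ∀ γ : GeodesicSegment X,
    γ.initial = x0 → γ.terminal = ρ (φ ^ n) x0 →
    ∀ p ∈ proj γ (ρ g x0), ∀ q ∈ proj γ (ρ (g * φ ^ n) x0),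
      γ.Before p q → E0 < dist p q →
      ∃ i j : ℕ, i ≤ n ∧ j ≤ n ∧ (wordDist S (φ ^ i) (g * φ ^ j) : ℝ) < E0)

/-- The set `V_{L,ε}(n)`. Here `Υ` is the chosen geodesic `Υ_L = [x₀, φ^L x₀]`. -/
def Vset (S : Finset G) (ρ : G → X → X) (hisom : ∀ g : G, Isometry (ρ g)) (x0 : X)
    (δ E0 : ℝ) (Υ : GeodesicSegment X) (ε : ℝ) (n : ℕ) : Set G :=
  {g | g ∈ ball S (n:ℝ) ∧ ∃ h : ℕ → G,
    AlignedSeq (6 * E0 + 300 * δ)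
      ([GeodesicSegment.point x0] ++ transList ρ hisom Υ h ⌈ε * (n:ℝ)⌉₊ ++
        [GeodesicSegment.point (ρ g x0)])}

/-- The set `W_{L,ε}(n)`. Here `Υ` is the chosen geodesic `Υ_L = [x₀, φ^L x₀]`. -/
def Wset (S : Finset G) (ρ : G → X → X) (hisom : ∀ g : G, Isometry (ρ g)) (x0 : X)
    (δ E0 : ℝ) (Υ : GeodesicSegment X) (ε : ℝ) (n : ℕ) : Set G :=
  {g | g ∈ ball S (n:ℝ) ∧ ∃ h : ℕ → G,
    AlignedSeq (6 * E0 + 360 * δ)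
      ([GeodesicSegment.point x0] ++ transList ρ hisom Υ h ⌈ε * (n:ℝ)⌉₊ ++
        [GeodesicSegment.point (ρ g x0)]) ∧
    AlignedPair (6 * E0 + 360 * δ) (GeodesicSegment.point (ρ g⁻¹ x0))
      (Υ.translate (ρ (h 1)) (hisom _)) ∧
    AlignedPair (6 * E0 + 360 * δ) (Υ.translate (ρ (h ⌈ε * (n:ℝ)⌉₊)) (hisom _))
      (GeodesicSegment.point (ρ (g ^ 2) x0))}

/-- The set `BAD_{L,ε}(n)`. -/
def BADset (S : Finset G) (ρ : G → X → X) (hisom : ∀ g : G, Isometry (ρ g)) (x0 : X)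
    (δ E0 : ℝ) (Υ : GeodesicSegment X) (ε : ℝ) (n : ℕ) : Set G :=
  ball S (n:ℝ) \ (ball S ((⌊(0.9:ℝ) * (n:ℝ)⌋₊ : ℕ) : ℝ) ∪ Vset S ρ hisom x0 δ E0 Υ ε n)

/-! ### Paths in the word metric -/

/-- `P` is a `d_S`-path connecting `a` to `b`. -/
noncomputable def IsPathFrom (S : Finset G) (P : List G) (a b : G) : Prop :=
  P ≠ [] ∧ P.Chain' (fun u v => wordDist S u v = 1) ∧ P.head? = some a ∧ P.getLast? = some b

/-- The distance `d_S(P, g)` from a path `P` to a group element `g`. -/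
noncomputable def pathDist (S : Finset G) (P : List G) (g : G) : ℕ :=
  sInf {d | ∃ v ∈ P, d = wordDist S v g}


/-! ### Gromov products -/

theorem gromovProd_comm (x y z : X) : gromovProd x y z = gromovProd x z y := by
  simp only [gromovProd, dist_comm]
  ring

theorem gromovProd_add (x y z : X) : gromovProd x y z + gromovProd y x z = dist x y := by
  simp only [gromovProd, dist_comm]
  ring

theorem gromovProd_nonneg (x y z : X) : 0 ≤ gromovProd x y z := by
  have := dist_triangle y x z
  simp only [gromovProd]
  linarith

theorem gromovProd_le_dist (x y z : X) : gromovProd x y z ≤ dist x z := by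
  have := dist_triangle y z x
  simp only [gromovProd, dist_comm] at *
  linarith

theorem gromovProd_self_left (x y : X) : gromovProd x x y = 0 := by
  simp [gromovProd]

theorem gromovProd_self_right (x y : X) : gromovProd x y x = 0 := by
  simp [gromovProd, dist_comm]

theorem gromovProd_le_add_dist (x y y' z : X) :
    gromovProd x y z ≤ gromovProd x y' z + dist y y' := by
  have h1 := dist_triangle y y' x
  have h2 := dist_triangle y' y z
  have h3 := dist_comm y y'
  simp only [gromovProd]
  linarith

theorem dist_sub_dist_le_gromovProd (x y z : X) : dist x y - dist y z ≤ gromovProd x y z := by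
  have := dist_triangle x z y
  simp only [gromovProd, dist_comm] at *
  linarith

theorem gromovProd_image {f : X → X} (hf : Isometry f) (x y z : X) :
    gromovProd (f x) (f y) (f z) = gromovProd x y z := by
  simp only [gromovProd, hf.dist_eq]

/-- The four-point form of hyperbolicity, with constant `D`. -/
def FourPoint (X : Type*) [MetricSpace X] (D : ℝ) : Prop :=
  ∀ w x y z : X, gromovProd w x y ≤ gromovProd w x z + D ∨
    gromovProd w y z ≤ gromovProd w x z + D

/-- If `y` lies far away from `w` in the direction of `x`, then `(y, z)_w` is controlled
by `(x, z)_w`. -/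
theorem FourPoint.le_of_lt {D : ℝ} (h4 : FourPoint X D) {w x y z : X}
    (h : gromovProd w x z + D < gromovProd w x y) :
    gromovProd w y z ≤ gromovProd w x z + D :=
  (h4 w x y z).resolve_left (not_le.2 h)

/-- If two points `e`, `f` are behind `b` as seen from `a`, then so is every point `w` near
a geodesic from `e` to `f`. -/
theorem FourPoint.gromovProd_between {D : ℝ} (h4 : FourPoint X D) (hD : 0 ≤ D)
    {a b e f w : X} {C₁ C₂ : ℝ}
    (hw : gromovProd w e f ≤ C₁) (he : gromovProd b a e ≤ C₂) (hf : gromovProd b a f ≤ C₂) :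
    gromovProd b a w ≤ C₁ + 2 * C₂ + 2 * D := by
  have h1 := gromovProd_nonneg w e f
  have h2 := gromovProd_nonneg b a e
  rcases h4 b a w e with h | h
  · linarith
  rcases h4 b a w f with h' | h'
  · linarith
  have h5 := gromovProd_le_dist b a w
  have h6 : dist b w ≤ C₁ + 2 * C₂ + 2 * D := by
    have h7 := dist_triangle e b f
    simp only [gromovProd, dist_comm] at *
    linarith
  linarith

/-- Propagation along consecutive segments `[a, b]` and `[s, t]`: a point which is beyond
the second segment is also beyond the first one. -/
theorem FourPoint.gromovProd_propagate {D : ℝ} (h4 : FourPoint X D)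
    {a b s t y : X} {C : ℝ} (hC : 0 ≤ C) (hD : 0 ≤ D) (hR : 4 * C + 4 * D < dist s t)
    (h1 : gromovProd b a t ≤ C) (h2 : gromovProd s b t ≤ C)
    (hy : gromovProd t s y ≤ C + D) : gromovProd b a y ≤ C + D := by
  have e1 := gromovProd_add s t b
  have e2 := gromovProd_comm s b t
  have e3 : gromovProd t b y ≤ C + 2 * D := by
    have := h4.le_of_lt (w := t) (x := s) (y := b) (z := y) (by linarith)
    linarith
  have e4 := gromovProd_add b t y
  have e5 : dist s t - 2 * C ≤ dist b t := by
    have := dist_nonneg (x := b) (y := s)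
    simp only [gromovProd, dist_comm] at *
    linarith
  rcases h4 b a y t with h | h
  · linarith
  · rw [gromovProd_comm b y t] at h
    linarith

/-- Consecutive segments `[a k, b k]`, `0 ≤ k ≤ n`, where every segment is located beyond
the preceding one. -/
structure SegmentChain (C R : ℝ) (n : ℕ) (a b : ℕ → X) : Prop where
  length : ∀ k ≤ n, R < dist (a k) (b k)
  terminal_terminal : ∀ k < n, gromovProd (b k) (a k) (b (k + 1)) ≤ C
  terminal_initial : ∀ k < n, gromovProd (b k) (a k) (a (k + 1)) ≤ C
  initial_terminal : ∀ k < n, gromovProd (a (k + 1)) (b (k + 1)) (b k) ≤ C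
  initial_initial : ∀ k < n, gromovProd (a (k + 1)) (b (k + 1)) (a k) ≤ C

theorem SegmentChain.reverse {C R : ℝ} {n : ℕ} {a b : ℕ → X} (h : SegmentChain C R n a b) :
    SegmentChain C R n (fun k => b (n - k)) (fun k => a (n - k)) where
  length k hk := by
    rw [dist_comm]
    exact h.length _ (Nat.sub_le _ _)
  terminal_terminal k hk := by
    have := h.initial_initial (n - (k + 1)) (by omega)
    rwa [show n - (k + 1) + 1 = n - k by omega] at this
  terminal_initial k hk := by
    have := h.initial_terminal (n - (k + 1)) (by omega)
    rwa [show n - (k + 1) + 1 = n - k by omega] at this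
  initial_terminal k hk := by
    have := h.terminal_initial (n - (k + 1)) (by omega)
    rwa [show n - (k + 1) + 1 = n - k by omega] at this
  initial_initial k hk := by
    have := h.terminal_terminal (n - (k + 1)) (by omega)
    rwa [show n - (k + 1) + 1 = n - k by omega] at this

theorem SegmentChain.mono {C C' R R' : ℝ} {n : ℕ} {a b : ℕ → X} (h : SegmentChain C R n a b)
    (hC : C ≤ C') (hR : R' ≤ R) : SegmentChain C' R' n a b where
  length k hk := hR.trans_lt (h.length k hk)
  terminal_terminal k hk := (h.terminal_terminal k hk).trans hC
  terminal_initial k hk := (h.terminal_initial k hk).trans hC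
  initial_terminal k hk := (h.initial_terminal k hk).trans hC
  initial_initial k hk := (h.initial_initial k hk).trans hC

theorem SegmentChain.propagate {C D : ℝ} {n : ℕ} {a b : ℕ → X}
    (h : SegmentChain C (4 * C + 4 * D) n a b) (h4 : FourPoint X D) (hC : 0 ≤ C) (hD : 0 ≤ D)
    {y : X} (hy : gromovProd (b n) (a n) y ≤ C + D) : gromovProd (b 0) (a 0) y ≤ C + D := by
  have key : ∀ j ≤ n, gromovProd (b (n - j)) (a (n - j)) y ≤ C + D := by
    intro j
    induction j with
    | zero => exact fun _ => hy
    | succ j ih =>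
      intro hj
      have e : n - j = n - (j + 1) + 1 := by omega
      have ih := ih (by omega)
      have h1 := h.initial_terminal (n - (j + 1)) (by omega)
      rw [gromovProd_comm] at h1
      rw [e] at ih
      exact h4.gromovProd_propagate hC hD (h.length _ (by omega))
        (h.terminal_terminal _ (by omega)) h1 ih
  simpa using key n le_rfl

/-- The orbit of a point under an isometry `f` stays beyond a chain of segments, provided this
holds for the first few points of the orbit. -/
theorem SegmentChain.orbit_beyond {C D : ℝ} {n : ℕ} {a b : ℕ → X}
    (h : SegmentChain C (12 * C + 20 * D) n a b) (h4 : FourPoint X D) (hC : 0 ≤ C) (hD : 0 ≤ D)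
    {f : X → X} (hf : Isometry f) {y : ℕ → X} (hy : ∀ i, f (y i) = y (i + 1))
    (h0 : gromovProd (a 0) (b 0) (y 0) ≤ C) (h1 : gromovProd (a 0) (b 0) (y 1) ≤ C)
    (h2 : gromovProd (b n) (a n) (y 2) ≤ C) (h3 : gromovProd (b n) (a n) (y 3) ≤ C) (i : ℕ) :
    gromovProd (b 0) (a 0) (y (i + 2)) ≤ 3 * C + 5 * D ∧
      gromovProd (b n) (a n) (y (i + 2)) ≤ 3 * C + 5 * D := by
  have hsmall : SegmentChain C (4 * C + 4 * D) n a b := h.mono le_rfl (by linarith)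
  have hbig : SegmentChain (3 * C + 4 * D) (4 * (3 * C + 4 * D) + 4 * D) n a b :=
    h.mono (by linarith) (by linarith)
  have len0 := h.length 0 (Nat.zero_le _)
  have lenn := h.length n le_rfl
  have hfb : gromovProd (f (b 0)) (f (a 0)) (y 3) ≤ C + D := by
    rw [← hy 2, gromovProd_image hf]
    exact hsmall.propagate h4 hC hD (by linarith)
  have hxa : gromovProd (a n) (b n) (y 1) ≤ C + D := by
    have := hsmall.reverse.propagate h4 hC hD (y := y 1) (by simp; linarith)
    simpa using this
  have hes : gromovProd (f (a 0)) (f (b 0)) (y 2) ≤ C := by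
    rw [← hy 1, gromovProd_image hf]
    exact h1
  have hxs : gromovProd (f (a 0)) (f (b 0)) (y 1) ≤ C := by
    rw [← hy 0, gromovProd_image hf]
    exact h0
  have lenf : dist (f (a 0)) (f (b 0)) = dist (a 0) (b 0) := hf.dist_eq _ _
  have hef : gromovProd (f (b 0)) (y 2) (y 3) ≤ C + 2 * D := by
    have e := gromovProd_add (f (a 0)) (f (b 0)) (y 2)
    have := h4.le_of_lt (w := f (b 0)) (x := f (a 0)) (y := y 2) (z := y 3) (by linarith)
    linarith
  have hxe : gromovProd (b n) (y 1) (y 2) ≤ C + D := by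
    have e := gromovProd_add (a n) (b n) (y 1)
    have := h4.le_of_lt (w := b n) (x := a n) (y := y 1) (z := y 2) (by linarith)
    linarith
  have hP1 : gromovProd (b n) (a n) (f (b 0)) ≤ 3 * C + 4 * D := by
    have := h4.gromovProd_between hD hef h2 h3
    linarith
  have hP2 : gromovProd (f (a 0)) (b n) (f (b 0)) ≤ 3 * C + 4 * D := by
    have := h4.gromovProd_between hD hxe hxs hes
    rw [gromovProd_comm]
    linarith
  induction i with
  | zero =>
    have := hbig.propagate h4 (by linarith) hD (y := y 2) (by linarith)
    exact ⟨by simpa using this.trans (by linarith), by simpa using h2.trans (by linarith)⟩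
  | succ i ih =>
    have e : gromovProd (f (b 0)) (f (a 0)) (y (i + 1 + 2)) ≤ 3 * C + 4 * D + D := by
      rw [show i + 1 + 2 = i + 2 + 1 by ring, ← hy, gromovProd_image hf]
      linarith [ih.1]
    have e' := h4.gromovProd_propagate (by linarith) hD (by linarith) hP1 hP2 e
    have := hbig.propagate h4 (by linarith) hD e'
    exact ⟨by linarith, by linarith⟩

/-! ### Projections to geodesics -/

namespace GeodesicSegment

/-- The part of a geodesic segment after the parameter `s`. -/
def suffix (γ : GeodesicSegment X) (s : ℝ) (hs : s ∈ Set.Icc 0 γ.len) :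
    GeodesicSegment X where
  len := γ.len - s
  len_nonneg := sub_nonneg.2 hs.2
  toFun t := γ.toFun (s + t)
  isom u hu v hv := by
    rw [γ.isom _ ⟨by linarith [hs.1, hu.1], by linarith [hu.2]⟩ _
      ⟨by linarith [hs.1, hv.1], by linarith [hv.2]⟩]
    congr 1
    ring

/-- The part of a geodesic segment before the parameter `s`, traversed backwards. -/
def revPrefix (γ : GeodesicSegment X) (s : ℝ) (hs : s ∈ Set.Icc 0 γ.len) :
    GeodesicSegment X where
  len := s
  len_nonneg := hs.1
  toFun t := γ.toFun (s - t)
  isom u hu v hv := by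
    rw [γ.isom _ ⟨by linarith [hu.2], by linarith [hs.2, hu.1]⟩ _
      ⟨by linarith [hv.2], by linarith [hs.2, hv.1]⟩, ← abs_neg]
    congr 1
    ring

variable (γ : GeodesicSegment X)

theorem zero_mem : (0 : ℝ) ∈ Set.Icc 0 γ.len := ⟨le_rfl, γ.len_nonneg⟩

theorem len_mem : γ.len ∈ Set.Icc 0 γ.len := ⟨γ.len_nonneg, le_rfl⟩

theorem initial_mem_seg : γ.initial ∈ γ.seg := ⟨0, γ.zero_mem, rfl⟩

theorem terminal_mem_seg : γ.terminal ∈ γ.seg := ⟨γ.len, γ.len_mem, rfl⟩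

theorem dist_initial {s : ℝ} (hs : s ∈ Set.Icc 0 γ.len) : dist γ.initial (γ.toFun s) = s := by
  rw [initial, γ.isom _ γ.zero_mem _ hs, zero_sub, abs_neg, abs_of_nonneg hs.1]

theorem dist_terminal {s : ℝ} (hs : s ∈ Set.Icc 0 γ.len) :
    dist (γ.toFun s) γ.terminal = γ.len - s := by
  rw [terminal, γ.isom _ hs _ γ.len_mem, abs_sub_comm, abs_of_nonneg (sub_nonneg.2 hs.2)]

theorem dist_initial_terminal : dist γ.initial γ.terminal = γ.len :=
  γ.dist_initial γ.len_mem

theorem isCompact_seg : IsCompact γ.seg := by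
  refine isCompact_Icc.image_of_continuousOn ?_
  have : LipschitzOnWith 1 γ.toFun (Set.Icc 0 γ.len) :=
    LipschitzOnWith.of_dist_le_mul fun s hs t ht => by
      simp [γ.isom s hs t ht, Real.dist_eq]
  exact this.continuousOn

theorem suffix_initial (s : ℝ) (hs : s ∈ Set.Icc 0 γ.len) :
    (γ.suffix s hs).initial = γ.toFun s := by
  simp [initial, suffix]

theorem suffix_terminal (s : ℝ) (hs : s ∈ Set.Icc 0 γ.len) :
    (γ.suffix s hs).terminal = γ.terminal := by
  simp [terminal, suffix]

theorem suffix_seg_subset (s : ℝ) (hs : s ∈ Set.Icc 0 γ.len) :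
    (γ.suffix s hs).seg ⊆ γ.seg := by
  rintro _ ⟨t, ht, rfl⟩
  exact ⟨s + t, ⟨add_nonneg hs.1 ht.1, by linarith [show t ≤ γ.len - s from ht.2]⟩, rfl⟩

theorem revPrefix_initial (s : ℝ) (hs : s ∈ Set.Icc 0 γ.len) :
    (γ.revPrefix s hs).initial = γ.toFun s := by
  simp [initial, revPrefix]

theorem revPrefix_terminal (s : ℝ) (hs : s ∈ Set.Icc 0 γ.len) :
    (γ.revPrefix s hs).terminal = γ.initial := by
  simp [initial, terminal, revPrefix]

theorem revPrefix_seg_subset (s : ℝ) (hs : s ∈ Set.Icc 0 γ.len) :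
    (γ.revPrefix s hs).seg ⊆ γ.seg := by
  rintro _ ⟨t, ht, rfl⟩
  have ht2 : t ≤ s := ht.2
  exact ⟨s - t, ⟨sub_nonneg.2 ht2, by linarith [hs.2, ht.1]⟩, rfl⟩

end GeodesicSegment

theorem proj_nonempty (γ : GeodesicSegment X) (x : X) : (proj γ x).Nonempty := by
  obtain ⟨p, hp, h⟩ := γ.isCompact_seg.exists_infDist_eq_dist ⟨_, γ.initial_mem_seg⟩ x
  exact ⟨p, hp, h.symm⟩

/-- In a hyperbolic space, if the initial point of a geodesic is a closest point to `y`, then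
going through it is almost the shortest way from `y` to the terminal point. -/
theorem IsDeltaHyperbolic.dist_add_dist_le {δ : ℝ} (hhyp : IsDeltaHyperbolic X δ) (hδ : 0 < δ)
    (hgeo : IsGeodesicSpace X) (η : GeodesicSegment X) (y : X)
    (hy : ∀ r ∈ η.seg, dist y η.initial ≤ dist y r) :
    dist y η.initial + dist η.initial η.terminal ≤ dist y η.terminal + 16 * δ := by
  rcases lt_or_ge η.len (5 * δ) with hlen | hlen
  · have h1 := hy _ η.terminal_mem_seg
    rw [η.dist_initial_terminal]
    linarith
  obtain ⟨γ₁, h1i, h1t⟩ := hgeo η.initial y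
  obtain ⟨γ₂, h2i, h2t⟩ := hgeo y η.terminal
  have h5 : 5 * δ ∈ Set.Icc 0 η.len := ⟨by linarith, hlen⟩
  have hr : η.toFun (5 * δ) ∈ η.seg := ⟨_, h5, rfl⟩
  have hmem := Metric.cthickening_subset_thickening' (by linarith : 0 < 2 * δ)
    (by linarith : δ < 2 * δ) _ (hhyp γ₁ γ₂ η h1i (h1t.trans h2i.symm) h2t hr)
  obtain ⟨z, hz, hrz⟩ := Metric.mem_thickening_iff.1 hmem
  have d1 := η.dist_initial h5
  have d2 := η.dist_terminal h5
  have d3 := η.dist_initial_terminal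
  have hyr := hy _ hr
  set r := η.toFun (5 * δ)
  rcases hz with ⟨t, ht, rfl⟩ | ⟨t, ht, rfl⟩
  · have e1 := γ₁.dist_initial ht
    have e2 := γ₁.dist_terminal ht
    have e3 := γ₁.dist_initial_terminal
    rw [h1i] at e1 e3
    rw [h1t] at e2 e3
    have t1 := dist_triangle η.initial (γ₁.toFun t) r
    have t2 := dist_triangle y (γ₁.toFun t) r
    simp only [dist_comm] at *
    linarith
  · have e1 := γ₂.dist_initial ht
    have e2 := γ₂.dist_terminal ht
    have e3 := γ₂.dist_initial_terminal
    rw [h2i] at e1 e3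
    rw [h2t] at e2 e3
    have t1 := dist_triangle r (γ₂.toFun t) η.terminal
    have t2 := dist_triangle y (γ₂.toFun t) r
    simp only [dist_comm] at *
    linarith

theorem dist_le_of_mem_proj {γ : GeodesicSegment X} {y p r : X} (hp : p ∈ proj γ y)
    (hr : r ∈ γ.seg) : dist y p ≤ dist y r :=
  hp.2.trans_le (Metric.infDist_le_dist_of_mem hr)

theorem IsDeltaHyperbolic.dist_proj_terminal {δ : ℝ} (hhyp : IsDeltaHyperbolic X δ) (hδ : 0 < δ)
    (hgeo : IsGeodesicSpace X) {γ : GeodesicSegment X} {y p : X} (hp : p ∈ proj γ y) :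
    dist y p + dist p γ.terminal ≤ dist y γ.terminal + 16 * δ := by
  obtain ⟨s, hs, rfl⟩ := hp.1
  have := hhyp.dist_add_dist_le hδ hgeo (γ.suffix s hs) y fun r hr => by
    rw [γ.suffix_initial]
    exact dist_le_of_mem_proj hp (γ.suffix_seg_subset s hs hr)
  rwa [γ.suffix_initial, γ.suffix_terminal] at this

theorem IsDeltaHyperbolic.dist_proj_initial {δ : ℝ} (hhyp : IsDeltaHyperbolic X δ) (hδ : 0 < δ)
    (hgeo : IsGeodesicSpace X) {γ : GeodesicSegment X} {y p : X} (hp : p ∈ proj γ y) :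
    dist y p + dist p γ.initial ≤ dist y γ.initial + 16 * δ := by
  obtain ⟨s, hs, rfl⟩ := hp.1
  have := hhyp.dist_add_dist_le hδ hgeo (γ.revPrefix s hs) y fun r hr => by
    rw [γ.revPrefix_initial]
    exact dist_le_of_mem_proj hp (γ.revPrefix_seg_subset s hs hr)
  rwa [γ.revPrefix_initial, γ.revPrefix_terminal] at this

/-- Slim triangles imply the four-point condition. -/
theorem IsDeltaHyperbolic.fourPoint {δ : ℝ} (hhyp : IsDeltaHyperbolic X δ) (hδ : 0 < δ)
    (hgeo : IsGeodesicSpace X) : FourPoint X (18 * δ) := by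
  intro w x y z
  obtain ⟨γ, hγi, hγt⟩ := hgeo x z
  obtain ⟨γ₁, h1i, h1t⟩ := hgeo x y
  obtain ⟨γ₂, h2i, h2t⟩ := hgeo y z
  obtain ⟨p, hp⟩ := proj_nonempty γ w
  have d1 := hhyp.dist_proj_terminal hδ hgeo hp
  have d2 := hhyp.dist_proj_initial hδ hgeo hp
  rw [hγt] at d1
  rw [hγi] at d2
  have d3 := dist_triangle x p z
  have hmem := Metric.cthickening_subset_thickening' (by linarith : 0 < 2 * δ)
    (by linarith : δ < 2 * δ) _ (hhyp γ₁ γ₂ γ (h1i.trans hγi.symm) (h1t.trans h2i.symm)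
      (h2t.trans hγt.symm) hp.1)
  obtain ⟨q, hq, hpq⟩ := Metric.mem_thickening_iff.1 hmem
  have d4 := dist_triangle w p q
  rcases hq with ⟨t, ht, rfl⟩ | ⟨t, ht, rfl⟩
  · left
    have e1 := γ₁.dist_initial ht
    have e2 := γ₁.dist_terminal ht
    have e3 := γ₁.dist_initial_terminal
    rw [h1i] at e1 e3
    rw [h1t] at e2 e3
    have t1 := dist_triangle x (γ₁.toFun t) w
    have t2 := dist_triangle w (γ₁.toFun t) y
    simp only [gromovProd, dist_comm] at *
    linarith
  · right
    have e1 := γ₂.dist_initial ht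
    have e2 := γ₂.dist_terminal ht
    have e3 := γ₂.dist_initial_terminal
    rw [h2i] at e1 e3
    rw [h2t] at e2 e3
    have t1 := dist_triangle y (γ₂.toFun t) w
    have t2 := dist_triangle w (γ₂.toFun t) z
    simp only [gromovProd, dist_comm] at *
    linarith

theorem isBounded_projSet (γ : GeodesicSegment X) (A : Set X) :
    Bornology.IsBounded (projSet γ A) :=
  γ.isCompact_seg.isBounded.subset (Set.iUnion₂_subset fun _ _ _ hp => hp.1)

theorem dist_lt_of_diam_projSet_lt {K : ℝ} {γ : GeodesicSegment X} {A : Set X} {x y p : X}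
    (h : Metric.diam (projSet γ A ∪ {x}) < K) (hy : y ∈ A) (hp : p ∈ proj γ y) :
    dist p x < K :=
  (Metric.dist_le_diam_of_mem ((isBounded_projSet γ A).union Bornology.isBounded_singleton)
    (Or.inl (Set.mem_biUnion hy hp)) (Or.inr rfl)).trans_lt h

/-- In an aligned pair, the second segment is located beyond the terminal point of the first. -/
theorem AlignedPair.gromovProd_terminal_le {K δ : ℝ} {γ η : GeodesicSegment X}
    (h : AlignedPair K γ η) (hhyp : IsDeltaHyperbolic X δ) (hδ : 0 < δ)
    (hgeo : IsGeodesicSpace X) {y : X} (hy : y ∈ η.seg) :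
    gromovProd γ.terminal γ.initial y ≤ K + 8 * δ := by
  obtain ⟨p, hp⟩ := proj_nonempty γ y
  have h1 := dist_lt_of_diam_projSet_lt h.1 hy hp
  have h2 := hhyp.dist_proj_initial hδ hgeo hp
  have h3 := dist_triangle y p γ.terminal
  have h4 := dist_triangle γ.initial p γ.terminal
  simp only [gromovProd, dist_comm] at *
  linarith

/-- In an aligned pair, the first segment is located before the initial point of the second. -/
theorem AlignedPair.gromovProd_initial_le {K δ : ℝ} {γ η : GeodesicSegment X}
    (h : AlignedPair K γ η) (hhyp : IsDeltaHyperbolic X δ) (hδ : 0 < δ)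
    (hgeo : IsGeodesicSpace X) {y : X} (hy : y ∈ γ.seg) :
    gromovProd η.initial η.terminal y ≤ K + 8 * δ := by
  obtain ⟨p, hp⟩ := proj_nonempty η y
  have h1 := dist_lt_of_diam_projSet_lt h.2 hy hp
  have h2 := hhyp.dist_proj_terminal hδ hgeo hp
  have h3 := dist_triangle y p η.initial
  have h4 := dist_triangle η.terminal p η.initial
  simp only [gromovProd, dist_comm] at *
  linarith

/-- If a geodesic from `u` to `v` passes near `a` and then near `b`, `y` is located before `a` and
`z` is located beyond `b`, then projections of `y` and `z` occur in the correct order and are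
almost as far apart as `a` and `b`. -/
theorem IsDeltaHyperbolic.exists_proj_before {δ : ℝ} (hhyp : IsDeltaHyperbolic X δ) (hδ : 0 < δ)
    (hgeo : IsGeodesicSpace X) {γ : GeodesicSegment X} {a b y z : X} {C : ℝ}
    (hab : 2 * C + 18 * δ < dist a b)
    (ha : gromovProd a γ.initial b ≤ C) (hb : gromovProd b a γ.terminal ≤ C)
    (hy : gromovProd a b y ≤ C) (hz : gromovProd b a z ≤ C)
    {ℓ : ℝ} (hℓ : 0 ≤ ℓ) (hℓ' : ℓ + 4 * C + 52 * δ ≤ dist a b) :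
    ∃ p ∈ proj γ y, ∃ q ∈ proj γ z, γ.Before p q ∧ ℓ ≤ dist p q := by
  have h4 := hhyp.fourPoint hδ hgeo
  obtain ⟨p, hp⟩ := proj_nonempty γ y
  obtain ⟨q, hq⟩ := proj_nonempty γ z
  refine ⟨p, hp, q, hq, ?_⟩
  have p1 := hhyp.dist_proj_initial hδ hgeo hp
  have p2 := hhyp.dist_proj_terminal hδ hgeo hp
  have q1 := hhyp.dist_proj_initial hδ hgeo hq
  have q2 := hhyp.dist_proj_terminal hδ hgeo hq
  have p3 := dist_triangle y p γ.initial
  have p4 := dist_triangle y p γ.terminal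
  have q3 := dist_triangle z q γ.initial
  have q4 := dist_triangle z q γ.terminal
  obtain ⟨s, hs, rfl⟩ := hp.1
  obtain ⟨t, ht, rfl⟩ := hq.1
  rw [dist_comm (γ.toFun s) γ.initial, γ.dist_initial hs] at p1 p3
  rw [γ.dist_terminal hs] at p2 p4
  rw [dist_comm (γ.toFun t) γ.initial, γ.dist_initial ht] at q1 q3
  rw [γ.dist_terminal ht] at q2 q4
  have e1 := gromovProd_add a b γ.terminal
  have e2 := gromovProd_comm b a γ.terminal
  have e3 := gromovProd_add a b γ.initial
  have e4 := gromovProd_comm a b γ.initial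
  have f1 : gromovProd a y γ.terminal ≤ C + 18 * δ := by
    have := h4.le_of_lt (w := a) (x := b) (y := γ.terminal) (z := y) (by linarith)
    rw [gromovProd_comm]
    linarith
  have f2 : gromovProd b z γ.initial ≤ C + 18 * δ := by
    have := h4.le_of_lt (w := b) (x := a) (y := γ.initial) (z := z) (by linarith)
    rw [gromovProd_comm]
    linarith
  have g1 := dist_triangle z b γ.terminal
  have g2 := dist_triangle y a γ.initial
  have key : ℓ ≤ t - s := by
    simp only [gromovProd, dist_comm] at *
    linarith
  exact ⟨⟨s, t, hs, ht, by linarith, rfl, rfl⟩, by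
    rw [γ.isom _ hs _ ht, abs_sub_comm]
    exact key.trans (le_abs_self _)⟩

/-! ### Orbits of loxodromic isometries -/

/-- A local-to-global principle: if `d(z 0, z 2)` is definitely larger than `d(z 0, z 1)` along an
orbit `z`, then the Gromov products `(z 0, z n)_{z 1}` are controlled. -/
theorem FourPoint.gromovProd_orbit_le {D : ℝ} (h4 : FourPoint X D) (hD : 0 ≤ D) {z : ℤ → X}
    (hz : ∀ i j k, dist (z (i + k)) (z (j + k)) = dist (z i) (z j))
    (hz2 : dist (z 0) (z 1) + 4 * D < dist (z 0) (z 2)) (n : ℕ) :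
    gromovProd (z 1) (z 0) (z (n + 1)) ≤ gromovProd (z 1) (z 0) (z 2) + D := by
  have d12 : dist (z 1) (z 2) = dist (z 0) (z 1) := hz 0 1 1
  induction n with
  | zero =>
    have := gromovProd_nonneg (z 1) (z 0) (z 2)
    rw [Nat.cast_zero, zero_add, gromovProd_self_right]
    linarith
  | succ n ih =>
    have e : gromovProd (z 2) (z 1) (z (n + 1 + 1)) = gromovProd (z 1) (z 0) (z (n + 1)) := by
      have h1 := hz 0 1 1
      have h2 := hz (n + 1) 1 1
      have h3 := hz 0 (n + 1) 1
      simp only [gromovProd]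
      norm_num at h1 h2 h3
      rw [h1, h3, dist_comm (z 2), h2, dist_comm (z 1)]
    have e1 := gromovProd_add (z 1) (z 2) (z (n + 1 + 1))
    have e2 : gromovProd (z 1) (z 0) (z 2) = dist (z 0) (z 1) - dist (z 0) (z 2) / 2 := by
      rw [gromovProd, d12]
      ring
    push_cast
    have e3 := h4.le_of_lt (w := z 1) (x := z 2) (y := z (n + 1 + 1)) (z := z 0) (by
      rw [gromovProd_comm (z 1) (z 2) (z 0)]
      linarith)
    rwa [gromovProd_comm, gromovProd_comm (z 1) (z 2)] at e3

theorem FourPoint.gromovProd_two_sided_le {D : ℝ} (h4 : FourPoint X D) (hD : 0 ≤ D) {z : ℤ → X}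
    (hz : ∀ i j k, dist (z (i + k)) (z (j + k)) = dist (z i) (z j))
    (hz2 : dist (z 0) (z 1) + 4 * D < dist (z 0) (z 2)) (k l : ℕ) :
    gromovProd (z 0) (z (-k)) (z l) ≤ gromovProd (z 1) (z 0) (z 2) + 2 * D := by
  have hc := gromovProd_nonneg (z 1) (z 0) (z 2)
  rcases k with _ | k
  · rw [Nat.cast_zero, neg_zero, gromovProd_self_left]
    linarith
  rcases l with _ | l
  · rw [Nat.cast_zero, gromovProd_self_right]
    linarith
  have r1 : dist (z 0) (z (-1)) = dist (z 0) (z 1) := by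
    have := hz 0 (-1) 1
    norm_num at this
    rw [← this, dist_comm]
  have r2 : dist (z 0) (z (-2)) = dist (z 0) (z 2) := by
    have := hz 0 (-2) 2
    norm_num at this
    rw [← this, dist_comm]
  have r3 : dist (z (-1)) (z (-2)) = dist (z 0) (z 1) := by
    have := hz (-1) (-2) 2
    norm_num at this
    rw [← this, dist_comm]
  have d12 : dist (z 1) (z 2) = dist (z 0) (z 1) := hz 0 1 1
  have hfwd := h4.gromovProd_orbit_le hD hz hz2 (l + 1)
  have hbwd := h4.gromovProd_orbit_le hD (z := fun i => z (-i))
    (fun i j k => by rw [neg_add, neg_add, hz]) (by simpa [r1, r2] using hz2) k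
  have hbwd' : gromovProd (z (-1)) (z 0) (z (-((k + 1 : ℕ) : ℤ))) ≤
      gromovProd (z 1) (z 0) (z 2) + D := by
    have e : gromovProd (z (-1)) (z 0) (z (-2)) = gromovProd (z 1) (z 0) (z 2) := by
      simp only [gromovProd, r1, r2, r3, d12]
    rw [← e]
    simpa using hbwd
  have hfwd' : gromovProd (z 0) (z (-1)) (z ((l + 1 : ℕ) : ℤ)) ≤
      gromovProd (z 1) (z 0) (z 2) + D := by
    have h1 := hz (-1) 0 1
    have h2 := hz 0 (l + 1 : ℕ) 1
    have h3 := hz (-1) (l + 1 : ℕ) 1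
    norm_num at h1 h2 h3 hfwd
    rw [gromovProd] at hfwd ⊢
    push_cast
    rwa [← h1, ← h2, ← h3]
  have e1 := gromovProd_add (z 0) (z (-1)) (z (-((k + 1 : ℕ) : ℤ)))
  have e2 : gromovProd (z 1) (z 0) (z 2) = dist (z 0) (z 1) - dist (z 0) (z 2) / 2 := by
    rw [gromovProd, d12]
    ring
  rcases h4 (z 0) (z (-1)) (z (-((k + 1 : ℕ) : ℤ))) (z ((l + 1 : ℕ) : ℤ)) with h | h
  · linarith
  · linarith

/-- Orbits with positive escape rate are quasi-geodesic, in the sense that Gromov products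
`(x_{-k}, x_l)_{x_0}` are uniformly bounded. -/
theorem FourPoint.exists_gromovProd_le {D : ℝ} (h4 : FourPoint X D) (hD : 0 ≤ D) {x : ℤ → X}
    (hx : ∀ i j k, dist (x (i + k)) (x (j + k)) = dist (x i) (x j)) {τ : ℝ} (hτ : 0 < τ)
    (hlim : Filter.Tendsto (fun n : ℕ => dist (x 0) (x n) / n) Filter.atTop (nhds τ)) :
    ∃ C : ℝ, 0 ≤ C ∧ ∀ k l : ℕ, gromovProd (x 0) (x (-k)) (x l) ≤ C := by
  have hev1 : ∀ᶠ n : ℕ in Filter.atTop, dist (x 0) (x n) / n < 5 / 4 * τ :=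
    hlim.eventually_lt_const (by linarith)
  have hev2 : ∀ᶠ n : ℕ in Filter.atTop, 3 / 4 * τ < dist (x 0) (x n) / n :=
    hlim.eventually_const_lt (by linarith)
  obtain ⟨N1, hN1⟩ := Filter.eventually_atTop.1 (hev1.and hev2)
  obtain ⟨N2, hN2⟩ := exists_nat_gt (16 * D / τ)
  set N := max N1 (max N2 1) with hN
  have hNpos : 0 < N := by omega
  have hNr : (0 : ℝ) < N := by exact_mod_cast hNpos
  have hgap : dist (x 0) (x N) + 4 * D < dist (x 0) (x (2 * N)) := by
    have a1 := (hN1 N (by omega)).1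
    have a2 := (hN1 (2 * N) (by omega)).2
    have a3 : (N2 : ℝ) ≤ N := by exact_mod_cast (by omega : N2 ≤ N)
    have a4 := hN2.trans_le a3
    push_cast at a2
    rw [div_lt_iff₀ hNr] at a1
    rw [lt_div_iff₀ (by positivity)] at a2
    rw [div_lt_iff₀ hτ] at a4
    linarith
  let z : ℤ → X := fun i => x (i * N)
  have hz : ∀ i j k, dist (z (i + k)) (z (j + k)) = dist (z i) (z j) := fun i j k => by
    simp only [z, add_mul, hx]
  have hbd := h4.gromovProd_two_sided_le hD hz (by simpa [z] using hgap)
  have hpos := gromovProd_nonneg (z 1) (z 0) (z 2)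
  set c := gromovProd (z 1) (z 0) (z 2)
  set M := ∑ r ∈ Finset.range N, dist (x 0) (x r) with hM
  have hr : ∀ r < N, dist (x 0) (x r) ≤ M := fun r hr =>
    Finset.single_le_sum (f := fun r : ℕ => dist (x 0) (x r)) (fun _ _ => dist_nonneg)
      (Finset.mem_range.2 hr)
  have hM0 : 0 ≤ M := Finset.sum_nonneg fun _ _ => dist_nonneg
  refine ⟨c + 2 * D + 2 * M, by linarith, fun k l => ?_⟩
  have hk : dist (x (-k)) (z (-(k / N : ℕ))) ≤ M := by
    have h1 := hx 0 (k % N : ℕ) (-k)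
    have h2 : ((k % N : ℕ) : ℤ) + -k = -(k / N : ℕ) * N := by
      have : ((k % N + N * (k / N) : ℕ) : ℤ) = k := by rw [Nat.mod_add_div]
      push_cast at this ⊢
      linarith
    rw [h2, zero_add] at h1
    exact h1.trans_le (hr _ (Nat.mod_lt _ hNpos))
  have hl : dist (x l) (z (l / N : ℕ)) ≤ M := by
    have h1 := hx 0 (l % N : ℕ) ((l / N : ℕ) * N)
    have h2 : ((l % N : ℕ) : ℤ) + (l / N : ℕ) * N = l := by
      have : ((l % N + N * (l / N) : ℕ) : ℤ) = l := by rw [Nat.mod_add_div]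
      push_cast at this ⊢
      linarith
    rw [h2, zero_add] at h1
    rw [dist_comm]
    exact h1.trans_le (hr _ (Nat.mod_lt _ hNpos))
  have b1 := hbd (k / N) (l / N)
  have hz0 : z 0 = x 0 := by simp [z]
  rw [hz0] at b1
  have b2 := gromovProd_le_add_dist (x 0) (x (-k)) (z (-(k / N : ℕ))) (x l)
  have b3 := gromovProd_le_add_dist (x 0) (x l) (z (l / N : ℕ)) (z (-(k / N : ℕ)))
  rw [gromovProd_comm] at b3
  rw [gromovProd_comm (x 0) (z _) (z _)] at b3
  linarith

/-- The escape rate is a lower bound for normalized displacements. -/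
theorem mul_le_dist_of_tendsto {x : ℤ → X}
    (hx : ∀ i j k, dist (x (i + k)) (x (j + k)) = dist (x i) (x j)) {τ : ℝ}
    (hlim : Filter.Tendsto (fun n : ℕ => dist (x 0) (x n) / n) Filter.atTop (nhds τ)) (n : ℕ) :
    τ * n ≤ dist (x 0) (x n) := by
  rcases Nat.eq_zero_or_pos n with rfl | hn
  · simp
  have hsub : ∀ k : ℕ, dist (x 0) (x ((n * k : ℕ) : ℤ)) ≤ k * dist (x 0) (x n) := by
    intro k
    induction k with
    | zero => simp
    | succ k ih =>
      have h1 := dist_triangle (x 0) (x ((n * k : ℕ) : ℤ)) (x ((n * (k + 1) : ℕ) : ℤ))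
      have h2 := hx 0 n (n * k : ℕ)
      rw [zero_add, show (n : ℤ) + (n * k : ℕ) = ((n * (k + 1) : ℕ) : ℤ) by
        push_cast; ring] at h2
      push_cast at *
      linarith
  have hnr : (0 : ℝ) < n := by exact_mod_cast hn
  rw [← le_div_iff₀ hnr]
  have htend := hlim.comp (Filter.tendsto_id.const_mul_atTop' hn)
  refine le_of_tendsto htend ?_
  filter_upwards [Filter.eventually_gt_atTop 0] with k hk
  have hkr : (0 : ℝ) < k := by exact_mod_cast hk
  have := hsub k
  simp only [Function.comp_apply, id]
  rw [div_le_div_iff₀ (by push_cast; positivity) hnr]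
  push_cast at *
  nlinarith

/-! ### The main argument -/

/-- The alignment conditions on consecutive translates of a geodesic segment. -/
theorem alignedSeq_transList {Γ : Type*} {ρ : Γ → X → X} {hisom : ∀ g : Γ, Isometry (ρ g)}
    {Υ : GeodesicSegment X} {h : ℕ → Γ} {n : ℕ} {K : ℝ} {η₁ η₂ : GeodesicSegment X}
    (hA : AlignedSeq K ([η₁] ++ transList ρ hisom Υ h (n + 1) ++ [η₂])) :
    AlignedPair K η₁ (Υ.translate (ρ (h 1)) (hisom _)) ∧
    (∀ k < n, AlignedPair K (Υ.translate (ρ (h (k + 1))) (hisom _))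
      (Υ.translate (ρ (h (k + 2))) (hisom _))) ∧
    AlignedPair K (Υ.translate (ρ (h (n + 1))) (hisom _)) η₂ := by
  have hA' : List.IsChain (AlignedPair K)
    ([η₁] ++ transList ρ hisom Υ h (n + 1) ++ [η₂]) := hA
  rw [List.isChain_append, List.isChain_append] at hA'
  obtain ⟨⟨-, hmid, hfirst⟩, -, hlast⟩ := hA'
  refine ⟨hfirst η₁ rfl _ (by simp [transList, List.range_succ_eq_map]), ?_,
    hlast _ ?_ η₂ (by simp)⟩
  swap
  · rw [transList, List.range_succ, List.map_append, ← List.append_assoc]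
    exact List.getLast?_concat
  rw [transList, List.isChain_map, List.isChain_range_succ] at hmid
  exact hmid

/-- Lemma 4.4(3): for `g ∈ W_{L,ε}(n)` there is a conjugate `ψ` of `φ` such that for all
large `i` the projections of `g^{-i} x₀` and `g^{i} x₀` onto `[ψ^{-i} x₀, ψ^{i} x₀]` are
at least `τL/2` apart, in the correct order. -/
theorem Wset_conjugate_projection {G : Type*} [Group G] {X : Type*} [MetricSpace X]
    (S : Finset G) (hSgen : Subgroup.closure (S : Set G) = ⊤)
    (hNVC : NonVirtuallyCyclic G)
    (δ : ℝ) (hδ : 0 < δ) (hgeo : IsGeodesicSpace X) (hhyp : IsDeltaHyperbolic X δ)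
    (ρ : G → X → X) (hisom : ∀ g : G, Isometry (ρ g))
    (hmul : ∀ g h : G, ∀ x : X, ρ (g * h) x = ρ g (ρ h x)) (hone : ∀ x : X, ρ 1 x = x)
    (x0 : X) (φ : G)
    (τ : ℝ) (hτpos : 0 < τ)
    (hτ : Filter.Tendsto (fun n : ℕ => dist x0 (ρ (φ ^ n) x0) / n) Filter.atTop (nhds τ))
    (hwpd : HasWPD ρ x0 φ)
    (E0 : ℝ) (hE0 : E0Spec S ρ x0 φ E0) :
    ∃ L1 : ℝ, 0 < L1 ∧ ∀ L : ℕ, L1 < (L : ℝ) →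
      ∀ Υ : GeodesicSegment X, Υ.initial = x0 → Υ.terminal = ρ (φ ^ L) x0 →
      ∀ ε : ℝ, 0 < ε → ∀ n : ℕ, 1 ≤ ⌈ε * (n:ℝ)⌉₊ →
        ∀ g ∈ Wset S ρ hisom x0 δ E0 Υ ε n,
          ∃ h : G, ∃ i0 : ℕ, ∀ i : ℕ, i0 ≤ i →
            ∀ γ : GeodesicSegment X,
              γ.initial = ρ ((h * φ * h⁻¹) ^ (-(i:ℤ))) x0 →
              γ.terminal = ρ ((h * φ * h⁻¹) ^ (i:ℤ)) x0 →
              ∃ p ∈ proj γ (ρ (g ^ (-(i:ℤ))) x0), ∃ q ∈ proj γ (ρ (g ^ (i:ℤ)) x0),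
                γ.Before p q ∧ τ * (L : ℝ) / 2 ≤ dist p q := by
  have hD : (0 : ℝ) ≤ 18 * δ := by linarith
  have h4 := hhyp.fourPoint hδ hgeo
  have horb : ∀ (g : G) (i j k : ℤ), dist (ρ (g ^ (i + k)) x0) (ρ (g ^ (j + k)) x0) =
      dist (ρ (g ^ i) x0) (ρ (g ^ j) x0) := fun g i j k => by
    rw [add_comm i, add_comm j, zpow_add, zpow_add, hmul, hmul, (hisom _).dist_eq]
  have hφ := horb φ
  have hone' : ρ (φ ^ (0 : ℤ)) x0 = x0 := by rw [zpow_zero, hone]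
  have hlim : Filter.Tendsto (fun n : ℕ => dist (ρ (φ ^ (0 : ℤ)) x0) (ρ (φ ^ (n : ℤ)) x0) / n)
      Filter.atTop (nhds τ) := by
    simpa only [hone', zpow_natCast] using hτ
  obtain ⟨C₀, hC₀, hqg⟩ :=
    h4.exists_gromovProd_le (x := fun i : ℤ => ρ (φ ^ i) x0) hD hφ hτpos hlim
  have hdist := mul_le_dist_of_tendsto (x := fun i : ℤ => ρ (φ ^ i) x0) hφ hlim
  simp only [hone'] at hqg hdist
  set K : ℝ := 6 * E0 + 360 * δ with hK
  have hE : 0 < E0 := hE0.1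
  set C : ℝ := K + 8 * δ with hC
  have hCpos : 0 ≤ C := by linarith
  set C' : ℝ := C₀ + 3 * C + 90 * δ with hC'
  refine ⟨2 * (12 * C + 4 * C' + 400 * δ) / τ, by positivity, ?_⟩
  intro L hL Υ hΥi hΥt ε hε n hn g hg
  rw [div_lt_iff₀ hτpos] at hL
  obtain ⟨-, h, hseq, hfirst, hlast⟩ := hg
  obtain ⟨m, hm⟩ : ∃ m, ⌈ε * (n : ℝ)⌉₊ = m + 1 := ⟨_, (Nat.sub_add_cancel hn).symm⟩
  simp only [hm] at hseq hlast
  obtain ⟨hfirst', hmid, hlast'⟩ := alignedSeq_transList hseq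
  have hlen : τ * L ≤ dist x0 (ρ (φ ^ L) x0) := by simpa using hdist L
  have hti : ∀ w : G, (Υ.translate (ρ w) (hisom w)).initial = ρ w x0 := fun w => by
    rw [← hΥi]; rfl
  have htt : ∀ w : G, (Υ.translate (ρ w) (hisom w)).terminal = ρ w (ρ (φ ^ L) x0) := fun w => by
    rw [← hΥt]; rfl
  have hmi : ∀ w : G, ρ w x0 ∈ (Υ.translate (ρ w) (hisom w)).seg := fun w => by
    rw [← hti]; exact GeodesicSegment.initial_mem_seg _
  have hmt : ∀ w : G, ρ w (ρ (φ ^ L) x0) ∈ (Υ.translate (ρ w) (hisom w)).seg := fun w => by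
    rw [← htt]; exact GeodesicSegment.terminal_mem_seg _
  have hpt : ∀ x : X, x ∈ (GeodesicSegment.point x).seg :=
    fun x => (GeodesicSegment.point x).initial_mem_seg
  have hter : ∀ {w : G} {η : GeodesicSegment X} {y : X},
      AlignedPair K (Υ.translate (ρ w) (hisom w)) η → y ∈ η.seg →
        gromovProd (ρ w (ρ (φ ^ L) x0)) (ρ w x0) y ≤ C := fun {w η y} hA hy => by
    have := hA.gromovProd_terminal_le hhyp hδ hgeo hy
    rwa [hti, htt] at this
  have hini : ∀ {w : G} {η : GeodesicSegment X} {y : X},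
      AlignedPair K η (Υ.translate (ρ w) (hisom w)) → y ∈ η.seg →
        gromovProd (ρ w x0) (ρ w (ρ (φ ^ L) x0)) y ≤ C := fun {w η y} hA hy => by
    have := hA.gromovProd_initial_le hhyp hδ hgeo hy
    rwa [hti, htt] at this
  have hchain : SegmentChain C (12 * C + 20 * (18 * δ)) m (fun k => ρ (h (k + 1)) x0)
      (fun k => ρ (h (k + 1)) (ρ (φ ^ L) x0)) :=
    { length := fun k _ => by
        rw [(hisom _).dist_eq]
        linarith
      terminal_terminal := fun k hk => hter (hmid k hk) (hmt _)
      terminal_initial := fun k hk => hter (hmid k hk) (hmi _)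
      initial_terminal := fun k hk => hini (hmid k hk) (hmt _)
      initial_initial := fun k hk => hini (hmid k hk) (hmi _) }
  have hfwd : ∀ i : ℕ, gromovProd (ρ (h 1) (ρ (φ ^ L) x0)) (ρ (h 1) x0)
      (ρ (g ^ ((i : ℤ) + 1)) x0) ≤ 3 * C + 5 * (18 * δ) := fun i => by
    have := (hchain.orbit_beyond h4 hCpos hD (hisom g)
      (y := fun i : ℕ => ρ (g ^ ((i : ℤ) - 1)) x0)
      (fun i => by
        rw [← hmul, ← zpow_one_add]
        congr 2
        push_cast
        ring)
      (by simpa using hini hfirst (hpt _)) (by simpa [hone] using hini hfirst' (hpt _))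
      (by simpa using hter hlast' (hpt _))
      (by simpa using hter hlast (hpt _)) i).1
    convert this using 4
    push_cast
    ring
  have hbwd : ∀ i : ℕ, gromovProd (ρ (h 1) x0) (ρ (h 1) (ρ (φ ^ L) x0))
      (ρ (g ^ (-(i : ℤ))) x0) ≤ 3 * C + 5 * (18 * δ) := fun i => by
    have := (hchain.reverse.orbit_beyond h4 hCpos hD (hisom g⁻¹)
      (y := fun i : ℕ => ρ (g ^ (2 - (i : ℤ))) x0)
      (fun i => by
        rw [← hmul, ← zpow_neg_one, ← zpow_add]
        congr 2
        push_cast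
        ring)
      (by simpa using hter hlast (hpt _)) (by simpa using hter hlast' (hpt _))
      (by simpa [hone] using hini hfirst' (hpt _))
      (by simpa using hini hfirst (hpt _)) i).2
    simp only [Nat.sub_self, zero_add] at this
    convert this using 4
    push_cast
    ring
  obtain ⟨T, hT⟩ := exists_nat_gt ((C₀ + 18 * δ + dist x0 (ρ (h 1)⁻¹ x0)) / τ)
  rw [div_lt_iff₀ hτpos] at hT
  refine ⟨h 1, L + 1 + T, fun i hi γ hγi hγt => ?_⟩
  set v : X := ρ (h 1)⁻¹ x0 with hv
  rw [conj_zpow, hmul, hmul, ← hv] at hγi hγt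
  have hiT : (T : ℝ) ≤ (i - L : ℕ) := by exact_mod_cast (by omega : T ≤ i - L)
  have hiT' : (T : ℝ) ≤ i := by exact_mod_cast (by omega : T ≤ i)
  have hback : gromovProd x0 (ρ (φ ^ (-(i : ℤ))) v) (ρ (φ ^ L) x0) ≤ C₀ + 18 * δ := by
    have e1 := hqg i L
    rw [zpow_natCast φ L] at e1
    have e2 := dist_sub_dist_le_gromovProd x0 (ρ (φ ^ (-(i : ℤ))) x0) (ρ (φ ^ (-(i : ℤ))) v)
    rw [(hisom _).dist_eq] at e2
    have e3 := hφ (-(i : ℤ)) 0 i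
    rw [neg_add_cancel, zero_add, hone', dist_comm _ x0] at e3
    have e4 := hdist i
    have e5 := mul_le_mul_of_nonneg_left hiT' hτpos.le
    have := h4.le_of_lt (w := x0) (x := ρ (φ ^ (-(i : ℤ))) x0) (y := ρ (φ ^ (-(i : ℤ))) v)
      (z := ρ (φ ^ L) x0) (by linarith)
    linarith
  have hforw : gromovProd (ρ (φ ^ L) x0) x0 (ρ (φ ^ (i : ℤ)) v) ≤ C₀ + 18 * δ := by
    have hiL : (φ ^ (i : ℤ)) = φ ^ L * φ ^ ((i - L : ℕ) : ℤ) := by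
      rw [← zpow_natCast φ L, ← zpow_add]
      congr 1
      omega
    have e1 := hqg L (i - L)
    rw [← gromovProd_image (hisom (φ ^ L)), ← hmul (φ ^ L) (φ ^ _), ← hmul (φ ^ L) (φ ^ _),
      ← hiL, zpow_neg, zpow_natCast φ L, mul_inv_cancel, hone, gromovProd_comm] at e1
    have e2 := dist_sub_dist_le_gromovProd (ρ (φ ^ L) x0) (ρ (φ ^ (i : ℤ)) x0)
      (ρ (φ ^ (i : ℤ)) v)
    rw [(hisom (φ ^ (i : ℤ))).dist_eq, hiL, hmul, (hisom (φ ^ L)).dist_eq, ← hmul, ← hiL] at e2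
    have e4 := hdist (i - L)
    have e5 := mul_le_mul_of_nonneg_left hiT hτpos.le
    have := h4.le_of_lt (w := ρ (φ ^ L) x0) (x := ρ (φ ^ (i : ℤ)) x0)
      (y := ρ (φ ^ (i : ℤ)) v) (z := x0) (by linarith)
    rw [gromovProd_comm]
    linarith
  have hf := hfwd (i - 1)
  rw [show ((i - 1 : ℕ) : ℤ) + 1 = i by omega] at hf
  have hab : dist (ρ (h 1) x0) (ρ (h 1) (ρ (φ ^ L) x0)) = dist x0 (ρ (φ ^ L) x0) :=
    (hisom _).dist_eq _ _
  refine hhyp.exists_proj_before hδ hgeo (a := ρ (h 1) x0) (b := ρ (h 1) (ρ (φ ^ L) x0))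
    (C := C') ?_ ?_ ?_ ?_ ?_ (by positivity) ?_
  · linarith
  · rw [hγi, gromovProd_image (hisom _)]
    linarith
  · rw [hγt, gromovProd_image (hisom _)]
    linarith
  · linarith [hbwd i]
  · linarith
  · linarith

end AcylCount
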